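/- There is a universal constant C such that for every n ≥ 4 and every integer k ≥ 2 there is a (finitely supported) probability distribution over (deterministic) online geometric BST algorithms — a randomized online algorithm A — with the property that for every access sequence X = (x_1,…,x_m) ∈ [n]^m with m ≥ n·(log₂ n)², the expected cost satisfies E[cost_A(X)] ≤ C·(UB^k(X) + m·log₂ k·log₂ log₂ n). -/

import Mathlib

open scoped Classical

/-- A point set in the plane is arborally satisfied if every pair of points not on a common
horizontal or vertical line has a third point of the set in the closed rectangle it spans. -/
def ArbSatZ (P : Finset (ℤ × ℤ)) : Prop :=
  ∀ p ∈ P, ∀ q ∈ P, p.1 ≠ q.1 → p.2 ≠ q.2 →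
    ∃ r ∈ P, r ≠ p ∧ r ≠ q ∧ min p.1 q.1 ≤ r.1 ∧ r.1 ≤ max p.1 q.1 ∧
      min p.2 q.2 ≤ r.2 ∧ r.2 ≤ max p.2 q.2

/-- The geometric representation of an access sequence. -/
def Xp {n m : ℕ} (x : Fin m → Fin n) : Finset (ℤ × ℤ) :=
  Finset.univ.image (fun t : Fin m => (((x t : ℕ) : ℤ), ((t : ℕ) : ℤ)))

/-- An online geometric BST algorithm over the keys `[n]`: upon receiving an access it adds a
finite set of points at the current time, depending only on the accesses seen so far. -/
structure GeomAlg (n : ℕ) where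
  add : List (Fin n) → Finset (Fin n)

/-- The keys touched by the algorithm at time `t` (the accessed key, plus the added points,
which may depend only on the prefix `x_0, …, x_t` of the access sequence). -/
def GeomAlg.touched {n m : ℕ} (A : GeomAlg n) (x : Fin m → Fin n) (t : Fin m) :
    Finset (Fin n) :=
  insert (x t) (A.add ((List.ofFn x).take ((t : ℕ) + 1)))

/-- The point set produced by the algorithm on the access sequence `x`; it contains `Xp x`. -/
noncomputable def GeomAlg.points {n m : ℕ} (A : GeomAlg n) (x : Fin m → Fin n) : Finset (ℤ × ℤ) :=
  Finset.univ.biUnion (fun t : Fin m =>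
    (A.touched x t).image (fun a => (((a : ℕ) : ℤ), ((t : ℕ) : ℤ))))

/-- The cost of the algorithm on the access sequence `x`: the accessed points plus all added
points, i.e. `m` plus the number of added points. -/
def GeomAlg.cost {n m : ℕ} (A : GeomAlg n) (x : Fin m → Fin n) : ℕ :=
  ∑ t : Fin m, (A.touched x t).card

/-- A valid online geometric BST algorithm: on every access sequence of every length, the
produced point set is arborally satisfied. -/
def GeomAlg.Valid {n : ℕ} (A : GeomAlg n) : Prop :=
  ∀ (m : ℕ) (x : Fin m → Fin n), ArbSatZ (A.points x)

/-- The minimized quantity in the unified bound with time window `k` at time `t` (0-indexed):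
`min_{t' < t, t - t' ≤ k} (t - t' + |x_t - x_{t'}| + 2)`. -/
noncomputable def ubkVal {n m : ℕ} (k : ℕ) (x : Fin m → Fin n) (t : Fin m) : ℕ :=
  sInf { v : ℕ | ∃ t' : Fin m, t' < t ∧ (t : ℕ) ≤ (t' : ℕ) + k ∧
    v = ((t : ℕ) - (t' : ℕ)) + (max (x t : ℕ) (x t' : ℕ) - min (x t : ℕ) (x t' : ℕ)) + 2 }

/-- The unified bound with time window `k`:
`UB^k(X) = ∑_{t=2}^{m} log₂ (min_{max(1,t-k) ≤ t' ≤ t-1} (t - t' + |x_t - x_{t'}| + 2))`. -/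
noncomputable def UBk {n m : ℕ} (k : ℕ) (x : Fin m → Fin n) : ℝ :=
  ∑ t : Fin m, if 1 ≤ (t : ℕ) then Real.logb 2 (ubkVal k x t : ℝ) else 0

namespace TreapBST

open Finset

variable {n : ℕ} {α : Type*} [LinearOrder α]

/-- The ancestors of `z` (including `z`) in the treap with priorities `P`. -/
noncomputable def anc (P : Fin n → α) (z : Fin n) : Finset (Fin n) :=
  univ.filter fun a => ∀ c ∈ uIcc a z, P c ≤ P a

lemma mem_anc {P : Fin n → α} {a z : Fin n} :
    a ∈ anc P z ↔ ∀ c ∈ uIcc a z, P c ≤ P a := by simp [anc]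

lemma self_mem_anc (P : Fin n → α) (z : Fin n) : z ∈ anc P z := by simp [mem_anc]

lemma anc_trans {P : Fin n → α} {a b z : Fin n} (hab : a ∈ anc P b) (hbz : b ∈ anc P z) :
    a ∈ anc P z := by
  rw [mem_anc] at *
  intro c hc
  have hb := hab b right_mem_uIcc
  by_cases h : c ∈ uIcc a b
  · exact hab c h
  · refine (hbz c ?_).trans hb
    simp only [mem_uIcc'] at *
    grind

lemma mem_anc_of_mem_uIcc {P : Fin n → α} {a b d : Fin n} (hab : a ∈ anc P b)
    (hd : d ∈ uIcc a b) : a ∈ anc P d := by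
  rw [mem_anc] at *
  exact fun c hc => hab c (uIcc_subset_uIcc_left hd hc)

lemma exists_mem_anc_anc (P : Fin n → α) (a b : Fin n) :
    ∃ c ∈ uIcc a b, c ∈ anc P a ∧ c ∈ anc P b := by
  obtain ⟨c, hc, hmax⟩ := exists_max_image (uIcc a b) P ⟨a, left_mem_uIcc⟩
  refine ⟨c, hc, mem_anc.2 fun d hd => hmax d ?_, mem_anc.2 fun d hd => hmax d ?_⟩
  · exact uIcc_subset_uIcc hc left_mem_uIcc hd
  · exact uIcc_subset_uIcc hc right_mem_uIcc hd

/-- If each touched set is ancestor-closed for the treaps before and after it, and priorities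
change only at touched keys, then any two points span a rectangle with a third point. -/
lemma exists_between {T : ℕ → Finset (Fin n)} {P : ℕ → Fin n → α}
    (h₁ : ∀ t, ∀ b ∈ T t, anc (P t) b ⊆ T t) (h₂ : ∀ t, ∀ b ∈ T t, anc (P (t + 1)) b ⊆ T t)
    (h₃ : ∀ t, ∀ a ∉ T t, P (t + 1) a = P t a)
    {s t : ℕ} (hst : s < t) {a b : Fin n} (ha : a ∈ T s) (hb : b ∈ T t) (hab : a ≠ b) :
    ∃ c u, s ≤ u ∧ u ≤ t ∧ c ∈ uIcc a b ∧ c ∈ T u ∧ (c ≠ a ∨ u ≠ s) ∧ (c ≠ b ∨ u ≠ t) := by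
  obtain ⟨c, hc, hca, hcb⟩ := exists_mem_anc_anc (P t) a b
  by_cases hcb' : c = b
  · subst hcb'
    let U := (range t).filter fun u => (T u ∩ uIcc a c).Nonempty
    have hsU : s ∈ U := by
      simp only [U, mem_filter, mem_range]
      exact ⟨hst, a, by simp [ha]⟩
    obtain ⟨u, hu, hmax⟩ := exists_max_image U id ⟨s, hsU⟩
    have hu' := hu
    simp only [U, mem_filter, mem_range] at hu'
    obtain ⟨hut, d, hd⟩ := hu'
    rw [mem_inter] at hd
    have hconst : ∀ v, u + 1 ≤ v → v ≤ t → ∀ e ∈ uIcc a c, P v e = P (u + 1) e := by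
      intro v hv
      induction v, hv using Nat.le_induction with
      | base => intros; rfl
      | succ v hv ih =>
        intro hvt e he
        rw [← ih (by omega) e he]
        refine h₃ v e fun hev => ?_
        have := hmax v (by
          simp only [U, mem_filter, mem_range]
          exact ⟨by omega, e, mem_inter.2 ⟨hev, he⟩⟩)
        simp at this
        omega
    have hcd : c ∈ anc (P (u + 1)) d := by
      rw [mem_anc] at hca ⊢
      intro e he
      have he' : e ∈ uIcc a c := uIcc_subset_uIcc right_mem_uIcc hd.2 he
      rw [← hconst t hut le_rfl e he', ← hconst t hut le_rfl c right_mem_uIcc]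
      exact hca e (by rwa [uIcc_comm])
    exact ⟨c, u, hmax s hsU, hut.le, right_mem_uIcc, h₂ u d hd.1 hcd, Or.inl hab.symm,
      Or.inr hut.ne⟩
  · exact ⟨c, t, hst.le, le_rfl, hc, h₁ t b hb hcb, Or.inr hst.ne', Or.inl hcb'⟩

lemma arbSatZ_points {T : ℕ → Finset (Fin n)} {P : ℕ → Fin n → α}
    (h₁ : ∀ t, ∀ b ∈ T t, anc (P t) b ⊆ T t) (h₂ : ∀ t, ∀ b ∈ T t, anc (P (t + 1)) b ⊆ T t)
    (h₃ : ∀ t, ∀ a ∉ T t, P (t + 1) a = P t a)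
    {m : ℕ} (A : GeomAlg n) (x : Fin m → Fin n) (hA : ∀ t : Fin m, A.touched x t = T t) :
    ArbSatZ (A.points x) := by
  have hmem : ∀ p, p ∈ A.points x ↔
      ∃ (t : Fin m) (a : Fin n), a ∈ T t ∧ (((a : ℕ) : ℤ), ((t : ℕ) : ℤ)) = p := by
    intro p
    simp [GeomAlg.points, hA]
  intro p hp q hq hpq₁ hpq₂
  rw [hmem] at hp hq
  obtain ⟨s, a, ha, rfl⟩ := hp
  obtain ⟨t, b, hb, rfl⟩ := hq
  simp only [ne_eq, Nat.cast_inj, Fin.val_inj] at hpq₁ hpq₂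
  rcases lt_or_gt_of_ne hpq₂ with h | h
  · obtain ⟨c, u, hsu, hut, hc, hcu, hne₁, hne₂⟩ := exists_between h₁ h₂ h₃ h ha hb hpq₁
    refine ⟨(((c : ℕ) : ℤ), (u : ℤ)), (hmem _).2 ⟨⟨u, by omega⟩, c, hcu, rfl⟩, ?_⟩
    simp only [mem_uIcc', Fin.le_def, ne_eq, Prod.mk.injEq, Fin.ext_iff] at *
    omega
  · obtain ⟨c, u, hsu, hut, hc, hcu, hne₁, hne₂⟩ := exists_between h₁ h₂ h₃ h hb ha (Ne.symm hpq₁)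
    refine ⟨(((c : ℕ) : ℤ), (u : ℤ)), (hmem _).2 ⟨⟨u, by omega⟩, c, hcu, rfl⟩, ?_⟩
    simp only [mem_uIcc', Fin.le_def, ne_eq, Prod.mk.injEq, Fin.ext_iff] at *
    omega

/-- The keys touched when changing priorities from `P` to `P'` while accessing the keys `Z`. -/
noncomputable def touch (P P' : Fin n → α) (Z : Finset (Fin n)) : Finset (Fin n) :=
  Z.biUnion fun z => anc P z ∪ anc P' z

lemma touch_comm (P P' : Fin n → α) (Z : Finset (Fin n)) : touch P P' Z = touch P' P Z := by
  simp [touch, union_comm]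

lemma mem_touch {P P' : Fin n → α} {Z : Finset (Fin n)} {a : Fin n} :
    a ∈ touch P P' Z ↔ ∃ z ∈ Z, a ∈ anc P z ∨ a ∈ anc P' z := by simp [touch]

lemma anc_subset_touch {P P' : Fin n → α} {Z : Finset (Fin n)}
    (h : ∀ a, P a ≠ P' a → ∃ z ∈ Z, a ∈ anc P z) {b : Fin n} (hb : b ∈ touch P P' Z) :
    anc P b ⊆ touch P P' Z := by
  intro a ha
  rw [mem_touch] at *
  obtain ⟨z, hz, hb | hb⟩ := hb
  · exact ⟨z, hz, Or.inl (anc_trans ha hb)⟩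
  · by_cases hd : ∃ d ∈ uIcc a b, P d ≠ P' d
    · obtain ⟨d, hd, hne⟩ := hd
      obtain ⟨w, hw, hdw⟩ := h d hne
      exact ⟨w, hw, Or.inl (anc_trans (mem_anc_of_mem_uIcc ha hd) hdw)⟩
    · push Not at hd
      refine ⟨z, hz, Or.inr (anc_trans (b := b) ?_ hb)⟩
      rw [mem_anc] at ha ⊢
      intro c hc
      rw [← hd c hc, ← hd a left_mem_uIcc]
      exact ha c hc

/-- The keys where `L` first exceeds all values met on the way from `y`. -/
noncomputable def adj (L : Fin n → ℕ) (y : Fin n) : Finset (Fin n) :=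
  univ.filter fun a => ∀ c ∈ uIcc a y, c ≠ a → L c < L a

lemma mem_adj {L : Fin n → ℕ} {a y : Fin n} :
    a ∈ adj L y ↔ ∀ c ∈ uIcc a y, c ≠ a → L c < L a := by simp [adj]

/-- The keys activated by the accesses in `W`. -/
noncomputable def active (L : Fin n → ℕ) (W : Finset (Fin n)) : Finset (Fin n) := W.biUnion (adj L)

lemma mem_active {L : Fin n → ℕ} {W : Finset (Fin n)} {a : Fin n} :
    a ∈ active L W ↔ ∃ y ∈ W, a ∈ adj L y := by simp [active]

/-- Priorities: first the level, then activity, then the random permutation. -/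
noncomputable def prio (L : Fin n → ℕ) (π : Equiv.Perm (Fin n)) (W : Finset (Fin n)) (a : Fin n) :
    ℕ ×ₗ ℕ ×ₗ Fin n :=
  toLex (L a, toLex (if a ∈ active L W then 1 else 0, π a))

lemma prio_le_prio {L : Fin n → ℕ} {π : Equiv.Perm (Fin n)} {W : Finset (Fin n)} {a c : Fin n} :
    prio L π W c ≤ prio L π W a ↔ L c < L a ∨ L c = L a ∧
      ((c ∉ active L W ∧ a ∈ active L W) ∨ ((c ∈ active L W ↔ a ∈ active L W) ∧ π c ≤ π a)) := by
  simp only [prio, Prod.Lex.toLex_le_toLex]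
  split_ifs <;> simp [*]

lemma adj_subset_anc (L : Fin n → ℕ) (π : Equiv.Perm (Fin n)) (W : Finset (Fin n)) (y : Fin n) :
    adj L y ⊆ anc (prio L π W) y := by
  intro a ha
  rw [mem_adj] at ha
  rw [mem_anc]
  intro c hc
  by_cases h : c = a
  · rw [h]
  · exact prio_le_prio.2 (Or.inl (ha c hc h))

lemma card_adj_level_le (L : Fin n → ℕ) (y : Fin n) (j : ℕ) :
    ((adj L y).filter fun a => L a = j).card ≤ 2 := by
  have hsub : ((adj L y).filter fun a => L a = j) ⊆
      ((adj L y).filter fun a => L a = j ∧ a ≤ y) ∪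
        ((adj L y).filter fun a => L a = j ∧ y ≤ a) := by
    intro a
    simp only [mem_union, mem_filter]
    have := le_total a y
    tauto
  refine (card_le_card hsub).trans ((card_union_le _ _).trans (add_le_add (b := 1) (d := 1) ?_ ?_))
  all_goals
    rw [card_le_one]
    intro a ha b hb
    simp only [mem_filter, mem_adj, mem_uIcc'] at ha hb
    by_contra hne
    have h₁ := ha.1 b
    have h₂ := hb.1 a
    grind

lemma card_active_level_le (L : Fin n → ℕ) (W : Finset (Fin n)) (j : ℕ) :
    ((active L W).filter fun a => L a = j).card ≤ 2 * W.card := by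
  rw [active, filter_biUnion, mul_comm]
  exact card_biUnion_le_card_mul _ _ _ fun y _ => card_adj_level_le L y j

/-- `x` and `y` are not separated by keys of level at least `j`. -/
def Joined (L : Fin n → ℕ) (j : ℕ) (x y : Fin n) : Prop :=
  x = y ∨ ∀ c ∈ uIcc x y, L c < j

lemma Joined.symm {L : Fin n → ℕ} {j : ℕ} {x y : Fin n} (h : Joined L j x y) : Joined L j y x := by
  rcases h with h | h
  · exact Or.inl h.symm
  · exact Or.inr fun c hc => h c (by rwa [uIcc_comm])

lemma Joined.trans {L : Fin n → ℕ} {j : ℕ} {x y z : Fin n} (h : Joined L j x y)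
    (h' : Joined L j y z) : Joined L j x z := by
  rcases h with rfl | h
  · exact h'
  rcases h' with rfl | h'
  · exact Or.inr h
  refine Or.inr fun c hc => ?_
  by_cases hcy : c ∈ uIcc x y
  · exact h c hcy
  · refine h' c ?_
    simp only [mem_uIcc'] at *
    grind

/-- The class of `x` modulo `Joined`. -/
noncomputable def cell (L : Fin n → ℕ) (j : ℕ) (x : Fin n) : Finset (Fin n) :=
  univ.filter (Joined L j x)

lemma cell_eq_cell {L : Fin n → ℕ} {j : ℕ} {x y : Fin n} :
    cell L j x = cell L j y ↔ Joined L j x y := by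
  constructor
  · intro h
    have : y ∈ cell L j y := by simp [cell, Joined]
    rw [← h] at this
    simpa [cell] using this
  · intro h
    ext z
    simp only [cell, mem_filter, mem_univ, true_and]
    exact ⟨h.symm.trans, h.trans⟩

/-- Indicator that no access in `W` is joined to `x` at level `j`. -/
noncomputable def miss (L : Fin n → ℕ) (j : ℕ) (W : Finset (Fin n)) (x : Fin n) : ℕ :=
  if cell L j x ∈ W.image (cell L j) then 0 else 1

lemma miss_of_mem {L : Fin n → ℕ} {j : ℕ} {W : Finset (Fin n)} {x : Fin n} (h : x ∈ W) :
    miss L j W x = 0 := if_pos (mem_image_of_mem _ h)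

lemma miss_le_one {L : Fin n → ℕ} {j : ℕ} {W : Finset (Fin n)} {x : Fin n} :
    miss L j W x ≤ 1 := by unfold miss; split_ifs <;> simp

lemma mem_active_of_joined {L : Fin n → ℕ} {π : Equiv.Perm (Fin n)} {W : Finset (Fin n)}
    {a x y : Fin n} (hy : y ∈ W) (h : Joined L (L a) x y) (ha : a ∈ anc (prio L π W) x) :
    a ∈ active L W := by
  rw [mem_anc] at ha
  obtain ⟨u, hu, hmin⟩ := exists_min_image ((uIcc a x).filter fun c => L a ≤ L c)
    (fun c => ((c : ℤ) - (x : ℤ)).natAbs) ⟨a, by simp⟩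
  simp only [mem_filter] at hu hmin
  have hua := prio_le_prio.1 (ha u hu.1)
  have hLu : L u = L a := by omega
  have hux : ∀ c ∈ uIcc u x, c ≠ u → L c < L u := by
    intro c hc hcu
    by_contra hlt
    have hca : c ∈ uIcc a x := uIcc_subset_uIcc hu.1 right_mem_uIcc hc
    have := hmin c ⟨hca, by omega⟩
    clear hmin ha
    simp only [mem_uIcc', Fin.le_def, ne_eq, Fin.ext_iff] at hc hcu
    omega
  have huy : u ∈ adj L y := by
    rw [mem_adj]
    rcases h with rfl | h
    · exact hux
    intro c hc hcu
    by_cases hcx : c ∈ uIcc u x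
    · exact hux c hcx hcu
    · rw [hLu]
      refine h c ?_
      clear hux hua hmin ha h
      simp only [mem_uIcc'] at *
      omega
  have hact : u ∈ active L W := mem_active.2 ⟨y, hy, huy⟩
  rcases hua with hua | ⟨-, hua | hua⟩
  · omega
  · exact hua.2
  · exact hua.1.1 hact

lemma card_argmax_mul_card_le (A : Finset (Fin n)) {a : Fin n} (ha : a ∈ A) :
    (univ.filter fun π : Equiv.Perm (Fin n) => ∀ c ∈ A, π c ≤ π a).card * A.card ≤ n.factorial := by
  let E : Fin n → Finset (Equiv.Perm (Fin n)) := fun b => univ.filter fun π => ∀ c ∈ A, π c ≤ π b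
  have hcard : ∀ b ∈ A, (E a).card ≤ (E b).card := by
    intro b hb
    refine card_le_card_of_injOn (fun π => π * Equiv.swap a b)
      ?_ ?_
    · intro π hπ
      simp only [E, coe_filter, mem_univ, true_and, Set.mem_ofPred_eq, Equiv.Perm.coe_mul,
        Function.comp_apply, Equiv.swap_apply_right] at hπ ⊢
      intro c hc
      refine hπ _ ?_
      rw [Equiv.swap_apply_def]
      split_ifs <;> assumption
    · intro π _ π' _ h
      exact mul_right_cancel h
  have hdisj : (A : Set (Fin n)).PairwiseDisjoint E := by
    intro b hb c hc hbc
    rw [Function.onFun, disjoint_left]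
    intro π h h'
    simp only [E, mem_filter, mem_univ, true_and] at h h'
    exact hbc (π.injective (le_antisymm (h' b hb) (h c hc)))
  calc (E a).card * A.card = ∑ _b ∈ A, (E a).card := by simp [mul_comm]
    _ ≤ ∑ b ∈ A, (E b).card := sum_le_sum hcard
    _ = (A.biUnion E).card := (card_biUnion hdisj).symm
    _ ≤ (univ : Finset (Equiv.Perm (Fin n))).card := card_le_card (subset_univ _)
    _ = n.factorial := by simp [Fintype.card_perm]

lemma sum_inv_le_log {ι : Type*} (S : Finset ι) (f : ι → ℕ) (hf : Set.InjOn f S)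
    (h₁ : ∀ a ∈ S, 1 ≤ f a) {M : ℕ} (hM : ∀ a ∈ S, f a ≤ M) :
    ∑ a ∈ S, ((f a : ℝ))⁻¹ ≤ 1 + Real.log M := by
  rw [← sum_image (f := fun i : ℕ => ((i : ℝ))⁻¹) hf]
  refine le_trans (sum_le_sum_of_subset_of_nonneg (t := Icc 1 M) ?_ ?_) ?_
  · intro i hi
    obtain ⟨a, ha, rfl⟩ := mem_image.1 hi
    exact mem_Icc.2 ⟨h₁ a ha, hM a ha⟩
  · intros; positivity
  · have := harmonic_le_one_add_log M
    rw [harmonic_eq_sum_Icc] at this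
    push_cast at this
    exact this

/-- The expected number of records of a random permutation along the keys of `S`, walking away
from `x` in both directions, is logarithmic. -/
lemma sum_card_records_le (S : Finset (Fin n)) (x : Fin n) {M : ℕ} (hS : S.card ≤ M) :
    ∑ π : Equiv.Perm (Fin n),
      ((S.filter fun a => ∀ c ∈ S, c ∈ uIcc a x → π c ≤ π a).card : ℝ) ≤
      n.factorial * (2 * (1 + Real.logb 2 M)) := by
  have hlog : Real.log M ≤ Real.logb 2 M := by
    rw [Real.logb, le_div_iff₀ (Real.log_pos (by norm_num))]
    have h0 : 0 ≤ Real.log M := Real.log_natCast_nonneg M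
    nlinarith [Real.log_two_lt_d9]
  have hside : ∀ s : Finset (Fin n), s ⊆ S → Set.InjOn (fun a => (S.filter (· ∈ uIcc a x)).card) s →
      ∑ a ∈ s, (((S.filter (· ∈ uIcc a x)).card : ℝ))⁻¹ ≤ 1 + Real.logb 2 M := by
    intro s hs hinj
    refine (sum_inv_le_log s _ hinj ?_ (M := M) ?_).trans (by linarith)
    · intro a ha
      exact card_pos.2 ⟨a, by simp [hs ha]⟩
    · intro a _
      exact (card_le_card (filter_subset _ _)).trans hS
  have hlt : ∀ a b : Fin n, a ∈ S → b ∈ S → a ∈ uIcc b x → a ≠ b →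
      (S.filter (· ∈ uIcc a x)).card < (S.filter (· ∈ uIcc b x)).card := by
    intro a b _ hb hab hne
    refine card_lt_card ((ssubset_iff_of_subset ?_).2 ⟨b, by simp [hb], ?_⟩)
    · intro c hc
      simp only [mem_filter] at hc ⊢
      exact ⟨hc.1, uIcc_subset_uIcc hab right_mem_uIcc hc.2⟩
    · simp only [mem_filter, mem_uIcc'] at *
      grind
  have hL := hside (S.filter (· ≤ x)) (filter_subset _ _) (by
    intro a ha b hb hab
    simp only [coe_filter, Set.mem_ofPred_eq] at ha hb
    by_contra hne
    rcases lt_or_gt_of_ne hne with h | h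
    · exact (hlt b a hb.1 ha.1 (mem_uIcc'.2 (Or.inl ⟨h.le, hb.2⟩)) (Ne.symm hne)).ne hab.symm
    · exact (hlt a b ha.1 hb.1 (mem_uIcc'.2 (Or.inl ⟨h.le, ha.2⟩)) hne).ne hab)
  have hR := hside (S.filter (x ≤ ·)) (filter_subset _ _) (by
    intro a ha b hb hab
    simp only [coe_filter, Set.mem_ofPred_eq] at ha hb
    by_contra hne
    rcases lt_or_gt_of_ne hne with h | h
    · exact (hlt a b ha.1 hb.1 (mem_uIcc'.2 (Or.inr ⟨ha.2, h.le⟩)) hne).ne hab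
    · exact (hlt b a hb.1 ha.1 (mem_uIcc'.2 (Or.inr ⟨hb.2, h.le⟩)) (Ne.symm hne)).ne hab.symm)
  have hswap : ∑ π : Equiv.Perm (Fin n),
      ((S.filter fun a => ∀ c ∈ S, c ∈ uIcc a x → π c ≤ π a).card : ℝ) =
      ∑ a ∈ S, ((univ.filter fun π : Equiv.Perm (Fin n) =>
        ∀ c ∈ S.filter (· ∈ uIcc a x), π c ≤ π a).card : ℝ) := by
    simp_rw [card_filter, Nat.cast_sum]
    rw [sum_comm]
    simp only [mem_filter, and_imp]
  have hprob : ∀ a ∈ S, ((univ.filter fun π : Equiv.Perm (Fin n) =>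
        ∀ c ∈ S.filter (· ∈ uIcc a x), π c ≤ π a).card : ℝ) ≤
        n.factorial * (((S.filter (· ∈ uIcc a x)).card : ℝ))⁻¹ := by
    intro a ha
    have hmem : a ∈ S.filter (· ∈ uIcc a x) := by simp [ha]
    rw [← div_eq_mul_inv, le_div_iff₀ (by exact_mod_cast card_pos.2 ⟨a, hmem⟩)]
    exact_mod_cast card_argmax_mul_card_le _ hmem
  rw [hswap]
  refine (sum_le_sum hprob).trans ?_
  rw [← mul_sum]
  gcongr
  have hsplit : ∑ a ∈ S, (((S.filter (· ∈ uIcc a x)).card : ℝ))⁻¹ ≤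
      ∑ a ∈ S.filter (· ≤ x), (((S.filter (· ∈ uIcc a x)).card : ℝ))⁻¹ +
      ∑ a ∈ S.filter (x ≤ ·), (((S.filter (· ∈ uIcc a x)).card : ℝ))⁻¹ := by
    rw [sum_filter, sum_filter, ← sum_add_distrib]
    refine sum_le_sum fun a _ => ?_
    have h0 : 0 ≤ (((S.filter (· ∈ uIcc a x)).card : ℝ))⁻¹ := by positivity
    rcases le_total a x with h | h
    · rw [if_pos h]; split_ifs <;> linarith
    · rw [if_pos h]; split_ifs <;> linarith
  linarith

/-- Any interval of keys of level at most `j` has length at most `2 ^ 2 ^ j`. -/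
def Spread (L : Fin n → ℕ) : Prop :=
  ∀ j : ℕ, ∀ a z : Fin n, (∀ c ∈ uIcc a z, L c ≤ j) →
    (a : ℕ) < z + 2 ^ 2 ^ j ∧ (z : ℕ) < a + 2 ^ 2 ^ j

lemma level_le_of_mem_anc {L : Fin n → ℕ} {π : Equiv.Perm (Fin n)} {W : Finset (Fin n)}
    {a z c : Fin n} (h : a ∈ anc (prio L π W) z) (hc : c ∈ uIcc a z) : L c ≤ L a := by
  have := prio_le_prio.1 (mem_anc.1 h c hc)
  omega

lemma one_le_logb {v : ℕ} (hv : 2 ≤ v) : 1 ≤ Real.logb 2 v := by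
  rw [Real.le_logb_iff_rpow_le (by norm_num) (by positivity)]
  simpa using (by exact_mod_cast hv : (2 : ℝ) ≤ v)

lemma sum_card_anc_active_le (L : Fin n → ℕ) {W : Finset (Fin n)} {k : ℕ} (hk : 2 ≤ k)
    (hW : W.card ≤ k) (z : Fin n) (j : ℕ) :
    ∑ π : Equiv.Perm (Fin n),
      (((anc (prio L π W) z).filter fun a => L a = j ∧ a ∈ active L W).card : ℝ) ≤
      n.factorial * (6 * Real.logb 2 k) := by
  have hk1 := one_le_logb hk
  let S := (active L W).filter fun a => L a = j
  have hS : S.card ≤ 2 * k := (card_active_level_le L W j).trans (by omega)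
  refine (sum_le_sum (fun π _ => ?_)).trans
    ((sum_card_records_le S z hS).trans ?_)
  · gcongr
    intro a ha
    simp only [mem_filter, S] at ha ⊢
    refine ⟨⟨ha.2.2, ha.2.1⟩, fun c hc hcz => ?_⟩
    have := prio_le_prio.1 (mem_anc.1 ha.1 c hcz)
    have h1 := hc.1
    have h2 := ha.2.2
    rcases this with h | h
    · omega
    · tauto
  · refine mul_le_mul_of_nonneg_left ?_ (by positivity)
    push_cast
    rw [Real.logb_mul (by norm_num) (by positivity), Real.logb_self_eq_one (by norm_num)]
    linarith

lemma sum_card_anc_inactive_le {L : Fin n → ℕ} (hL : Spread L) (W : Finset (Fin n))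
    (z : Fin n) (j : ℕ) :
    ∑ π : Equiv.Perm (Fin n),
      (((anc (prio L π W) z).filter fun a => L a = j ∧ a ∉ active L W).card : ℝ) ≤
      n.factorial * (6 * 2 ^ j * miss L j W z) := by
  by_cases hm : cell L j z ∈ W.image (cell L j)
  · obtain ⟨y, hy, hyz⟩ := mem_image.1 hm
    rw [miss, if_pos hm]
    refine le_of_eq_of_le (sum_eq_zero fun π _ => ?_) (by simp)
    rw [Nat.cast_eq_zero, card_eq_zero, filter_eq_empty_iff]
    rintro a ha ⟨rfl, hna⟩
    exact hna (mem_active_of_joined hy (cell_eq_cell.1 hyz.symm) ha)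
  · rw [miss, if_neg hm]
    let S := univ.filter fun a : Fin n => L a = j ∧ a ∉ active L W ∧
      (a : ℕ) < z + 2 ^ 2 ^ j ∧ (z : ℕ) < a + 2 ^ 2 ^ j
    have hS : S.card ≤ 2 * 2 ^ 2 ^ j := by
      have : S.card ≤ (Ico ((z : ℕ) + 1 - 2 ^ 2 ^ j) ((z : ℕ) + 2 ^ 2 ^ j)).card := by
        refine card_le_card_of_injOn (fun a => (a : ℕ)) ?_ Fin.val_injective.injOn
        intro a ha
        simp only [S, coe_filter, mem_univ, true_and, Set.mem_ofPred_eq, coe_Ico, Set.mem_Ico] at ha ⊢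
        omega
      rw [Nat.card_Ico] at this
      have : 0 < 2 ^ 2 ^ j := by positivity
      omega
    refine (sum_le_sum (fun π _ => ?_)).trans
      ((sum_card_records_le S z hS).trans ?_)
    · gcongr
      intro a ha
      simp only [mem_filter, S, mem_univ, true_and] at ha ⊢
      obtain ⟨ha, rfl, hna⟩ := ha
      refine ⟨⟨rfl, hna, hL _ a z fun c hc => level_le_of_mem_anc ha hc⟩, fun c hc hcz => ?_⟩
      have := prio_le_prio.1 (mem_anc.1 ha c hcz)
      have h1 := hc.1
      have h2 := hc.2.1
      rcases this with h | h
      · omega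
      · tauto
    · refine mul_le_mul_of_nonneg_left ?_ (by positivity)
      push_cast
      rw [Real.logb_mul (by norm_num) (by positivity), Real.logb_self_eq_one (by norm_num),
        Real.logb_pow, Real.logb_self_eq_one (by norm_num)]
      have : (1 : ℝ) ≤ 2 ^ j := one_le_pow₀ (by norm_num)
      push_cast
      linarith

lemma sum_card_anc_le {L : Fin n → ℕ} (hL : Spread L) {J : ℕ} (hJ : ∀ a, L a ≤ J)
    {W : Finset (Fin n)} {k : ℕ} (hk : 2 ≤ k) (hW : W.card ≤ k) (z : Fin n) :
    ∑ π : Equiv.Perm (Fin n), ((anc (prio L π W) z).card : ℝ) ≤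
      n.factorial * ∑ j ∈ range (J + 1), (6 * Real.logb 2 k + 6 * 2 ^ j * miss L j W z) := by
  have hsplit : ∀ π : Equiv.Perm (Fin n), ((anc (prio L π W) z).card : ℝ) =
      ∑ j ∈ range (J + 1),
        ((((anc (prio L π W) z).filter fun a => L a = j ∧ a ∈ active L W).card : ℝ) +
        (((anc (prio L π W) z).filter fun a => L a = j ∧ a ∉ active L W).card : ℝ)) := by
    intro π
    rw [card_eq_sum_card_fiberwise (f := L) (t := range (J + 1))
      fun a _ => by simpa [Nat.lt_succ_iff] using hJ a]
    push_cast
    refine sum_congr rfl fun j _ => ?_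
    rw [← card_filter_add_card_filter_not (p := fun a => a ∈ active L W), filter_filter,
      filter_filter]
    push_cast
    rfl
  simp_rw [hsplit]
  rw [sum_comm, mul_sum]
  refine sum_le_sum fun j _ => ?_
  rw [sum_add_distrib, mul_add]
  exact add_le_add (sum_card_anc_active_le L hk hW z j) (sum_card_anc_inactive_le hL W z j)

/-- The keys accessed in the `k` steps before time `t`. -/
noncomputable def window (k : ℕ) (x : ℕ → Fin n) (t : ℕ) : Finset (Fin n) :=
  (Ico (t - k) t).image x

/-- The keys touched at time `t`: those needed to activate `x t` and to deactivate `x (t - k)`. -/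
noncomputable def step (L : Fin n → ℕ) (π : Equiv.Perm (Fin n)) (k : ℕ) (x : ℕ → Fin n) (t : ℕ) :
    Finset (Fin n) :=
  touch (prio L π (window k x t)) (prio L π (window k x (t + 1))) {x t, x (t - k)}

lemma card_window_le (k : ℕ) (x : ℕ → Fin n) (t : ℕ) : (window k x t).card ≤ k :=
  card_image_le.trans (by rw [Nat.card_Ico]; omega)

lemma window_congr {k : ℕ} {x y : ℕ → Fin n} {t : ℕ} (h : ∀ s < t, x s = y s) :
    window k x t = window k y t :=
  image_congr fun s hs => h s (mem_Ico.1 hs).2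

lemma step_congr {L : Fin n → ℕ} {π : Equiv.Perm (Fin n)} {k : ℕ} {x y : ℕ → Fin n} {t : ℕ}
    (h : ∀ s ≤ t, x s = y s) : step L π k x t = step L π k y t := by
  rw [step, step, window_congr fun s hs => h s hs.le, window_congr fun s hs => h s (by omega),
    h t le_rfl, h (t - k) (by omega)]

lemma self_mem_step (L : Fin n → ℕ) (π : Equiv.Perm (Fin n)) (k : ℕ) (x : ℕ → Fin n) (t : ℕ) :
    x t ∈ step L π k x t :=
  mem_touch.2 ⟨x t, by simp, Or.inl (self_mem_anc _ _)⟩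

lemma mem_window_succ (k : ℕ) (hk : 1 ≤ k) (x : ℕ → Fin n) (t : ℕ) : x t ∈ window k x (t + 1) :=
  mem_image_of_mem x (mem_Ico.2 (by omega))

lemma mem_window_or (k : ℕ) (x : ℕ → Fin n) (t : ℕ) (a : Fin n)
    (h : ¬ (a ∈ window k x t ↔ a ∈ window k x (t + 1))) : a = x t ∨ a = x (t - k) := by
  by_contra! hne
  refine h ?_
  simp only [window, mem_image, mem_Ico]
  constructor
  · rintro ⟨s, hs, rfl⟩
    have : s ≠ t - k := fun h => hne.2 (by rw [h])
    exact ⟨s, by omega, rfl⟩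
  · rintro ⟨s, hs, rfl⟩
    have : s ≠ t := fun h => hne.1 (by rw [h])
    exact ⟨s, by omega, rfl⟩

lemma exists_adj_of_prio_ne (L : Fin n → ℕ) (π : Equiv.Perm (Fin n)) (k : ℕ) (x : ℕ → Fin n)
    (t : ℕ) (a : Fin n)
    (h : prio L π (window k x t) a ≠ prio L π (window k x (t + 1)) a) :
    ∃ z ∈ ({x t, x (t - k)} : Finset (Fin n)), a ∈ adj L z := by
  by_contra! hne
  refine h ?_
  have : a ∈ active L (window k x t) ↔ a ∈ active L (window k x (t + 1)) := by
    rw [mem_active, mem_active]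
    refine exists_congr fun y => ?_
    by_cases hy : y ∈ window k x t ↔ y ∈ window k x (t + 1)
    · rw [hy]
    · have := hne y (by simpa using mem_window_or k x t y hy)
      simp [this]
  simp only [prio, this]

/-- The online algorithm touching the sets `step L π k`; `e` is a dummy key. -/
noncomputable def treapAlg (L : Fin n → ℕ) (π : Equiv.Perm (Fin n)) (k : ℕ) (e : Fin n) :
    GeomAlg n where
  add l := step L π k (fun s => l.getD s e) (l.length - 1)

lemma touched_treapAlg (L : Fin n → ℕ) (π : Equiv.Perm (Fin n)) (k : ℕ) (e : Fin n) {m : ℕ}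
    (x : Fin m → Fin n) (t : Fin m) :
    (treapAlg L π k e).touched x t = step L π k (fun s => (List.ofFn x).getD s e) t := by
  have hlen : ((List.ofFn x).take ((t : ℕ) + 1)).length - 1 = t := by
    simp only [List.length_take, List.length_ofFn]
    omega
  have hx : x t = (List.ofFn x).getD t e := by simp [List.getD]
  rw [GeomAlg.touched, treapAlg]
  dsimp only
  rw [hlen, step_congr (y := fun s => (List.ofFn x).getD s e), insert_eq_of_mem]
  · rw [hx]
    exact self_mem_step L π k (fun s => (List.ofFn x).getD s e) t
  · intro s hs
    simp only [List.getD, List.getElem?_take]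
    rw [if_pos (by omega)]

lemma valid_treapAlg (L : Fin n → ℕ) (π : Equiv.Perm (Fin n)) (k : ℕ) (e : Fin n) :
    (treapAlg L π k e).Valid := by
  intro m x
  set y : ℕ → Fin n := fun s => (List.ofFn x).getD s e
  refine arbSatZ_points (T := step L π k y) (P := fun t => prio L π (window k y t)) ?_ ?_ ?_
    (treapAlg L π k e) x fun t => touched_treapAlg L π k e x t
  · intro t b hb
    refine anc_subset_touch (fun a ha => ?_) hb
    obtain ⟨z, hz, haz⟩ := exists_adj_of_prio_ne L π k y t a ha
    exact ⟨z, hz, adj_subset_anc _ _ _ _ haz⟩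
  · intro t b hb
    rw [step, touch_comm] at hb ⊢
    refine anc_subset_touch (fun a ha => ?_) hb
    obtain ⟨z, hz, haz⟩ := exists_adj_of_prio_ne L π k y t a ha.symm
    exact ⟨z, hz, adj_subset_anc _ _ _ _ haz⟩
  · intro t a ha
    by_contra hne
    obtain ⟨z, hz, haz⟩ := exists_adj_of_prio_ne L π k y t a (Ne.symm hne)
    exact ha (mem_touch.2 ⟨z, hz, Or.inl (adj_subset_anc _ _ _ _ haz)⟩)

/-- Every class that leaves the window has entered it before. -/
lemma sum_miss_leave_le (L : Fin n → ℕ) (j k : ℕ) (hk : 1 ≤ k) (x : ℕ → Fin n) (m : ℕ) :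
    ∑ t ∈ range m, miss L j (window k x (t + 1)) (x (t - k)) ≤
      ∑ t ∈ range m, miss L j (window k x t) (x t) := by
  let V : ℕ → Finset (Finset (Fin n)) := fun t => (window k x t).image (cell L j)
  suffices h : (V m).card + ∑ t ∈ range m, miss L j (window k x (t + 1)) (x (t - k)) ≤
      ∑ t ∈ range m, miss L j (window k x t) (x t) by omega
  induction m with
  | zero => simp [V, window]
  | succ t ih =>
    rw [sum_range_succ, sum_range_succ]
    suffices h : (V (t + 1)).card + miss L j (window k x (t + 1)) (x (t - k)) ≤
        (V t).card + miss L j (window k x t) (x t) by omega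
    have hsub : V (t + 1) ⊆ insert (cell L j (x t)) (V t) := by
      intro c hc
      obtain ⟨y, hy, rfl⟩ := mem_image.1 hc
      obtain ⟨s, hs, rfl⟩ := mem_image.1 hy
      rw [mem_Ico] at hs
      by_cases hst : s = t
      · rw [hst]; exact mem_insert_self _ _
      · exact mem_insert_of_mem (mem_image_of_mem _ (mem_image_of_mem _ (mem_Ico.2 (by omega))))
    have hins : (insert (cell L j (x t)) (V t)).card =
        (V t).card + miss L j (window k x t) (x t) := by
      unfold miss
      split_ifs with h
      · rw [insert_eq_of_mem h, add_zero]
      · rw [card_insert_of_notMem h]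
    rw [← hins]
    by_cases h : cell L j (x (t - k)) ∈ V (t + 1)
    · rw [miss, if_pos h]
      exact card_le_card hsub
    · rw [miss, if_neg h, ← card_insert_of_notMem h]
      refine card_le_card (insert_subset ?_ hsub)
      rcases Nat.eq_zero_or_pos t with rfl | ht
      · simp
      · exact mem_insert_of_mem (mem_image_of_mem _ (mem_image_of_mem _ (mem_Ico.2 (by omega))))

lemma card_step_le (L : Fin n → ℕ) (π : Equiv.Perm (Fin n)) (k : ℕ) (x : ℕ → Fin n) (t : ℕ) :
    (step L π k x t).card ≤
      (anc (prio L π (window k x t)) (x t)).card +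
      (anc (prio L π (window k x (t + 1))) (x t)).card +
      ((anc (prio L π (window k x t)) (x (t - k))).card +
      (anc (prio L π (window k x (t + 1))) (x (t - k))).card) := by
  have : step L π k x t ⊆
      (anc (prio L π (window k x t)) (x t) ∪ anc (prio L π (window k x (t + 1))) (x t)) ∪
      (anc (prio L π (window k x t)) (x (t - k)) ∪
        anc (prio L π (window k x (t + 1))) (x (t - k))) := by
    intro a ha
    obtain ⟨z, hz, h⟩ := mem_touch.1 ha
    simp only [mem_insert, mem_singleton] at hz
    simp only [mem_union]
    rcases hz with rfl | rfl <;> tauto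
  exact (card_le_card this).trans ((card_union_le _ _).trans
    (add_le_add (card_union_le _ _) (card_union_le _ _)))

lemma sum_card_step_le {L : Fin n → ℕ} (hL : Spread L) {J : ℕ} (hJ : ∀ a, L a ≤ J)
    {k : ℕ} (hk : 2 ≤ k) (x : ℕ → Fin n) (m : ℕ) :
    ∑ π : Equiv.Perm (Fin n), ∑ t ∈ range m, ((step L π k x t).card : ℝ) ≤
      n.factorial * (24 * m * (J + 1) * Real.logb 2 k +
        18 * ∑ t ∈ range m, ∑ j ∈ range (J + 1), 2 ^ j * (miss L j (window k x t) (x t) : ℝ)) := by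
  have hstep : ∀ t, ∑ π : Equiv.Perm (Fin n), ((step L π k x t).card : ℝ) ≤
      n.factorial * ∑ j ∈ range (J + 1), (24 * Real.logb 2 k +
        6 * 2 ^ j * (2 * miss L j (window k x t) (x t) +
          miss L j (window k x (t + 1)) (x (t - k)))) := by
    intro t
    have h1 := sum_card_anc_le hL hJ hk (card_window_le k x t) (x t)
    have h2 := sum_card_anc_le hL hJ hk (card_window_le k x (t + 1)) (x t)
    have h3 := sum_card_anc_le hL hJ hk (card_window_le k x t) (x (t - k))
    have h4 := sum_card_anc_le hL hJ hk (card_window_le k x (t + 1)) (x (t - k))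
    have h5 : ∑ π : Equiv.Perm (Fin n), ((step L π k x t).card : ℝ) ≤ _ :=
      sum_le_sum fun π _ => Nat.cast_le.2 (card_step_le L π k x t)
    push_cast at h5
    rw [sum_add_distrib, sum_add_distrib, sum_add_distrib] at h5
    refine (h5.trans (add_le_add (add_le_add h1 h2) (add_le_add h3 h4))).trans ?_
    rw [← mul_add, ← mul_add, ← mul_add]
    refine mul_le_mul_of_nonneg_left ?_ (by positivity)
    rw [← sum_add_distrib, ← sum_add_distrib, ← sum_add_distrib]
    refine sum_le_sum fun j _ => ?_
    rw [miss_of_mem (mem_window_succ k (by omega) x t)]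
    have hy : (miss L j (window k x t) (x (t - k)) : ℝ) ≤ miss L j (window k x t) (x t) := by
      rcases Nat.eq_zero_or_pos t with rfl | ht
      · simp
      · have hmem : x (t - k) ∈ window k x t := mem_image_of_mem x (mem_Ico.2 (by omega))
        simp [miss_of_mem hmem]
    have := mul_le_mul_of_nonneg_left hy (by positivity : (0 : ℝ) ≤ 6 * 2 ^ j)
    push_cast
    linarith
  rw [sum_comm]
  refine (sum_le_sum fun t _ => hstep t).trans ?_
  rw [← mul_sum]
  refine mul_le_mul_of_nonneg_left ?_ (by positivity)
  simp_rw [sum_add_distrib]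
  refine add_le_add ?_ ?_
  · simp only [sum_const, card_range, nsmul_eq_mul]
    push_cast
    linarith
  · rw [sum_comm, sum_comm (s := range m), mul_sum]
    refine sum_le_sum fun j _ => ?_
    have h : (∑ t ∈ range m, (miss L j (window k x (t + 1)) (x (t - k)) : ℝ)) ≤
      ∑ t ∈ range m, (miss L j (window k x t) (x t) : ℝ) := by
      exact_mod_cast sum_miss_leave_le L j k (by omega) x m
    rw [← mul_sum, ← mul_sum, sum_add_distrib, ← mul_sum]
    have := mul_le_mul_of_nonneg_left h (by positivity : (0 : ℝ) ≤ 6 * 2 ^ j)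
    linarith

/-- The spacing of the keys of level at least `j`. -/
def spacing (j : ℕ) : ℕ := if j = 0 then 1 else 2 ^ 2 ^ (j - 1)

lemma spacing_pos (j : ℕ) : 0 < spacing j := by
  unfold spacing
  split_ifs <;> positivity

lemma spacing_dvd_spacing {i j : ℕ} (h : i ≤ j) : spacing i ∣ spacing j := by
  unfold spacing
  split_ifs
  · simp
  · simp
  · omega
  · exact pow_dvd_pow 2 (Nat.pow_le_pow_right (by norm_num) (by omega))

/-- The level of a key after a shift by `σ`. -/
def level (J σ : ℕ) (a : Fin n) : ℕ := Nat.findGreatest (fun j => spacing j ∣ a + σ) J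

lemma level_le (J σ : ℕ) (a : Fin n) : level J σ a ≤ J := Nat.findGreatest_le J

lemma spacing_dvd_of_le_level {J σ j : ℕ} {a : Fin n} (h : j ≤ level J σ a) :
    spacing j ∣ a + σ :=
  (spacing_dvd_spacing h).trans
    (Nat.findGreatest_spec (P := fun j => spacing j ∣ a + σ) (Nat.zero_le J) (by simp [spacing]))

lemma spread_level {J : ℕ} (hJ : n ≤ 2 ^ 2 ^ J) (σ : ℕ) : Spread (level (n := n) J σ) := by
  have key : ∀ j : ℕ, ∀ a z : Fin n, (∀ c ∈ uIcc a z, level J σ c ≤ j) →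
      (a : ℕ) < z + 2 ^ 2 ^ j := by
    intro j a z h
    have ha := a.2
    rcases lt_or_ge j J with hj | hj
    · by_contra! hlt
      have hmod : ((a : ℕ) + σ) % 2 ^ 2 ^ j < 2 ^ 2 ^ j := Nat.mod_lt _ (by positivity)
      let c : Fin n := ⟨a - (a + σ) % 2 ^ 2 ^ j, by omega⟩
      have hc := h c (by
        rw [mem_uIcc']
        simp only [Fin.le_def, c]
        omega)
      have : j + 1 ≤ level J σ c := by
        refine Nat.le_findGreatest hj ?_
        have : (c : ℕ) + σ = (a + σ) - (a + σ) % 2 ^ 2 ^ j := by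
          simp only [c]
          omega
        rw [this, spacing, if_neg (by omega), Nat.add_sub_cancel]
        exact Nat.dvd_sub_mod _
      omega
    · have : 2 ^ 2 ^ J ≤ 2 ^ 2 ^ j :=
        Nat.pow_le_pow_right (by norm_num) (Nat.pow_le_pow_right (by norm_num) hj)
      omega
  exact fun j a z h => ⟨key j a z h, key j z a fun c hc => h c (by rwa [uIcc_comm])⟩

lemma card_filter_dvd_add {N r : ℕ} (h : r ∣ N) (c : ℕ) :
    ((range N).filter fun σ => r ∣ c + σ).card = N / r := by
  have hp : Function.Periodic (fun i => r ∣ i) N := fun i => propext (Nat.dvd_add_left h)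
  have h₁ : ((range N).filter fun σ => r ∣ c + σ).card =
      ((Ico c (c + N)).filter fun i => r ∣ i).card := by
    rw [← card_map (addLeftEmbedding c), map_filter', range_eq_Ico, map_add_left_Ico]
    congr 1
    ext i
    simp only [mem_filter, mem_Ico, addLeftEmbedding_apply]
    refine and_congr_right fun hi => ⟨?_, fun hd => ⟨i - c, ?_⟩⟩
    · rintro ⟨a, ha, rfl⟩
      exact ha
    · have : c + (i - c) = i := by omega
      exact ⟨by rwa [this], this⟩
  have h₂ := Nat.filter_Ico_card_eq_of_periodic c N (fun i => r ∣ i) hp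
  have h₃ := Nat.filter_Ico_card_eq_of_periodic 1 N (fun i => r ∣ i) hp
  have h₄ := Nat.Ioc_filter_dvd_card_eq_div N r
  have h₅ : Ico 1 (1 + N) = Ioc 0 N := by
    ext i
    simp only [mem_Ico, mem_Ioc]
    omega
  rw [h₁, h₂, ← h₃, h₅, h₄]

lemma sum_miss_le {J j k t v : ℕ} (hj : j ≤ J) (x : ℕ → Fin n) {s : ℕ} (hs : s ∈ Ico (t - k) t)
    (hv : (uIcc (x t) (x s)).card ≤ v) :
    ∑ σ ∈ range (spacing J), (miss (level J σ) j (window k x t) (x t) : ℝ) ≤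
      spacing J * min 1 ((v : ℝ) / spacing j) := by
  have hpos : (0 : ℝ) < spacing j := by exact_mod_cast spacing_pos j
  rw [mul_min_of_nonneg _ _ (by positivity)]
  refine le_min ?_ ?_
  · calc ∑ σ ∈ range (spacing J), (miss (level J σ) j (window k x t) (x t) : ℝ)
        ≤ ∑ σ ∈ range (spacing J), (1 : ℝ) :=
          sum_le_sum fun σ _ => by exact_mod_cast miss_le_one
      _ = spacing J * 1 := by simp
  · have hmiss : ∀ σ, miss (level J σ) j (window k x t) (x t) ≤
        ∑ c ∈ uIcc (x t) (x s), if spacing j ∣ (c : ℕ) + σ then 1 else 0 := by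
      intro σ
      by_cases hc : ∃ c ∈ uIcc (x t) (x s), j ≤ level J σ c
      · obtain ⟨c, hc, hlev⟩ := hc
        refine miss_le_one.trans ?_
        refine le_trans ?_ (single_le_sum (fun _ _ => Nat.zero_le _) hc)
        rw [if_pos (spacing_dvd_of_le_level hlev)]
      · push Not at hc
        rw [miss, if_pos]
        · exact Nat.zero_le _
        · refine mem_image.2 ⟨x s, mem_image_of_mem x hs, ?_⟩
          exact (cell_eq_cell.2 (Or.inr hc)).symm
    have hsum : ∑ σ ∈ range (spacing J), miss (level J σ) j (window k x t) (x t) ≤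
        v * (spacing J / spacing j) := by
      refine (sum_le_sum fun σ _ => hmiss σ).trans ?_
      rw [sum_comm]
      simp_rw [← card_filter, card_filter_dvd_add (spacing_dvd_spacing hj)]
      rw [sum_const, smul_eq_mul]
      gcongr
    have := (Nat.cast_le (α := ℝ)).2 hsum
    rw [Nat.cast_mul, Nat.cast_div (spacing_dvd_spacing hj) hpos.ne'] at this
    push_cast at this
    calc _ ≤ _ := this
      _ = _ := by ring

lemma sum_min_two_pow_le {A : ℝ} (hA : 1 ≤ A) (M : ℕ) :
    ∑ i ∈ range M, min ((2 : ℝ) ^ i) (A ^ 2 / 2 ^ i) ≤ 4 * A := by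
  suffices h : ∑ i ∈ range M, min ((2 : ℝ) ^ i) (A ^ 2 / 2 ^ i) ≤
      if (2 : ℝ) ^ M ≤ 2 * A then (2 : ℝ) ^ M else 4 * A - 2 * (A ^ 2 / 2 ^ M) by
    refine h.trans ?_
    have : 0 ≤ A ^ 2 / 2 ^ M := by positivity
    split_ifs <;> linarith
  induction M with
  | zero =>
    simp only [range_zero, sum_empty]
    rw [if_pos (by linarith)]
    positivity
  | succ M ih =>
    rw [sum_range_succ]
    have hp : (0 : ℝ) < 2 ^ M := by positivity
    have hhalf : A ^ 2 / (2 : ℝ) ^ (M + 1) = A ^ 2 / 2 ^ M / 2 := by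
      rw [pow_succ (2 : ℝ) M, div_mul_eq_div_div]
    have h1 := min_le_left ((2 : ℝ) ^ M) (A ^ 2 / 2 ^ M)
    have h2 := min_le_right ((2 : ℝ) ^ M) (A ^ 2 / 2 ^ M)
    rw [hhalf, pow_succ (2 : ℝ) M]
    split_ifs at ih ⊢ with h h' h'
    · linarith
    · linarith
    · have : A ^ 2 / 2 ^ M ≤ A := by
        rw [div_le_iff₀ hp]
        nlinarith
      linarith
    · linarith

lemma sq_le_four_mul_two_pow (u : ℕ) : u ^ 2 ≤ 4 * 2 ^ u := by
  induction u with
  | zero => norm_num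
  | succ u ih =>
    rcases lt_or_ge u 3 with h | h
    · interval_cases u <;> norm_num
    · rw [pow_succ 2 u]
      nlinarith

lemma mul_min_div_two_pow_le {v : ℝ} (hv : 0 ≤ v) {l : ℕ} (hl : 2 ≤ l) (hvl : v ≤ 2 ^ l) {q : ℕ}
    (hq : 1 ≤ q) :
    (q : ℝ) * min 1 (v / 2 ^ q) ≤ min (q : ℝ) ((2 * l) ^ 2 / q) := by
  have hq0 : (0 : ℝ) < q := by exact_mod_cast hq
  have h1 : (q : ℝ) * min 1 (v / 2 ^ q) ≤ q := by
    nlinarith [min_le_left (1 : ℝ) (v / 2 ^ q)]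
  refine le_min h1 ?_
  rw [le_div_iff₀ hq0]
  rcases le_or_gt q (2 * l) with h | h
  · have : (q : ℝ) ≤ 2 * l := by exact_mod_cast h
    nlinarith
  · obtain ⟨u, rfl⟩ := Nat.exists_eq_add_of_le (show l ≤ q by omega)
    have hmin : min 1 (v / 2 ^ (l + u)) ≤ 1 / 2 ^ u := by
      refine (min_le_right _ _).trans ?_
      rw [pow_add, div_le_div_iff₀ (by positivity) (by positivity)]
      have : (0 : ℝ) < 2 ^ u := by positivity
      nlinarith
    have hsq : ((l + u : ℕ) : ℝ) ^ 2 ≤ (2 * l) ^ 2 * 2 ^ u := by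
      have h4 := sq_le_four_mul_two_pow u
      have h5 : (l + u) ^ 2 ≤ 4 * u ^ 2 := by nlinarith
      have h6 : 4 * 2 ^ u ≤ l ^ 2 * 2 ^ u := Nat.mul_le_mul_right _ (by nlinarith)
      have : (l + u) ^ 2 ≤ (2 * l) ^ 2 * 2 ^ u := by
        calc (l + u) ^ 2 ≤ 4 * (l ^ 2 * 2 ^ u) := by omega
          _ = _ := by ring
      exact_mod_cast this
    calc ((l + u : ℕ) : ℝ) * min 1 (v / 2 ^ (l + u)) * ((l + u : ℕ) : ℝ)
        = ((l + u : ℕ) : ℝ) ^ 2 * min 1 (v / 2 ^ (l + u)) := by ring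
      _ ≤ ((2 * l) ^ 2 * 2 ^ u) * (1 / 2 ^ u) := by gcongr
      _ = (2 * l) ^ 2 := by field_simp

lemma clog_le_logb_add_one {v : ℕ} (hv : 1 ≤ v) : (Nat.clog 2 v : ℝ) ≤ Real.logb 2 v + 1 := by
  rw [← Real.natCeil_logb_natCast]
  exact (Nat.ceil_lt_add_one (Real.logb_nonneg (by norm_num) (by exact_mod_cast hv))).le

lemma sum_two_pow_mul_min_le {v : ℕ} (hv : 3 ≤ v) (J : ℕ) :
    ∑ j ∈ range (J + 1), (2 : ℝ) ^ j * min 1 ((v : ℝ) / spacing j) ≤ 33 * Real.logb 2 v := by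
  set l := Nat.clog 2 v
  have hvl : v ≤ 2 ^ l := Nat.le_pow_clog (by norm_num) v
  have hl : 2 ≤ l := by
    by_contra! h
    have : 2 ^ l ≤ 2 ^ 1 := Nat.pow_le_pow_right (by norm_num) (by omega)
    omega
  have hl' : (2 : ℝ) ≤ l := by exact_mod_cast hl
  have hclog : (l : ℝ) ≤ Real.logb 2 v + 1 := clog_le_logb_add_one (by omega)
  have hlog := one_le_logb (v := v) (by omega)
  rw [sum_range_succ']
  have h0 : (2 : ℝ) ^ 0 * min 1 ((v : ℝ) / spacing 0) ≤ 1 := by simp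
  have hterm : ∀ i ∈ range J, (2 : ℝ) ^ (i + 1) * min 1 ((v : ℝ) / spacing (i + 1)) ≤
      2 * min ((2 : ℝ) ^ i) ((2 * l) ^ 2 / 2 ^ i) := by
    intro i _
    have := mul_min_div_two_pow_le (v := v) (by positivity) hl (by exact_mod_cast hvl)
      (q := 2 ^ i) Nat.one_le_two_pow
    rw [spacing, if_neg (by omega), Nat.add_sub_cancel, pow_succ]
    push_cast at this ⊢
    linarith
  have hsum := sum_le_sum hterm
  rw [← mul_sum] at hsum
  have := sum_min_two_pow_le (A := 2 * l) (by linarith) J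
  linarith

lemma sum_sum_miss_le {J k t v : ℕ} (hv : 3 ≤ v) (x : ℕ → Fin n) {s : ℕ}
    (hs : s ∈ Ico (t - k) t) (hcard : (uIcc (x t) (x s)).card ≤ v) :
    ∑ σ ∈ range (spacing J), ∑ j ∈ range (J + 1),
      2 ^ j * (miss (level J σ) j (window k x t) (x t) : ℝ) ≤
      spacing J * (33 * Real.logb 2 v) := by
  rw [sum_comm]
  calc _ ≤ ∑ j ∈ range (J + 1), (2 : ℝ) ^ j * (spacing J * min 1 ((v : ℝ) / spacing j)) := by
        refine sum_le_sum fun j hj => ?_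
        rw [← mul_sum]
        exact mul_le_mul_of_nonneg_left
          (sum_miss_le (Nat.lt_succ_iff.1 (mem_range.1 hj)) x hs hcard) (by positivity)
    _ = spacing J * ∑ j ∈ range (J + 1), (2 : ℝ) ^ j * min 1 ((v : ℝ) / spacing j) := by
        rw [mul_sum]
        exact sum_congr rfl fun j _ => by ring
    _ ≤ _ := mul_le_mul_of_nonneg_left (sum_two_pow_mul_min_le hv J) (by positivity)

lemma exists_ubkVal {m k : ℕ} (hk : 1 ≤ k) (x : Fin m → Fin n) (t : Fin m) (ht : 1 ≤ (t : ℕ)) :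
    ∃ s : Fin m, (s : ℕ) ∈ Ico ((t : ℕ) - k) t ∧ (uIcc (x t) (x s)).card ≤ ubkVal k x t ∧
      3 ≤ ubkVal k x t := by
  have hpred : (t : ℕ) - 1 < t := by omega
  have hne : { v : ℕ | ∃ t' : Fin m, t' < t ∧ (t : ℕ) ≤ (t' : ℕ) + k ∧
      v = ((t : ℕ) - (t' : ℕ)) +
        (max (x t : ℕ) (x t' : ℕ) - min (x t : ℕ) (x t' : ℕ)) + 2 }.Nonempty :=
    ⟨_, ⟨(t : ℕ) - 1, by omega⟩, hpred, by simp only; omega, rfl⟩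
  obtain ⟨s, hst, hsk, hv⟩ := Nat.sInf_mem hne
  rw [Fin.lt_def] at hst
  refine ⟨s, mem_Ico.2 (by omega), ?_, ?_⟩
  · rw [ubkVal, hv, Fin.card_uIcc]
    omega
  · rw [ubkVal, hv]
    omega

lemma sum_cost_treapAlg_le {J k : ℕ} (hJ : n ≤ 2 ^ 2 ^ J) (hk : 2 ≤ k) (e : Fin n) {m : ℕ}
    (x : Fin m → Fin n) :
    ∑ σ ∈ range (spacing J), ∑ π : Equiv.Perm (Fin n),
      ((treapAlg (level J σ) π k e).cost x : ℝ) ≤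
      n.factorial * spacing J * (24 * m * (J + 1) * Real.logb 2 k +
        18 * (33 * UBk k x + 2 ^ (J + 1))) := by
  set y : ℕ → Fin n := fun s => (List.ofFn x).getD s e
  have hy : ∀ t : Fin m, y t = x t := fun t => by simp [y, List.getD]
  have hcost : ∀ σ (π : Equiv.Perm (Fin n)), ((treapAlg (level J σ) π k e).cost x : ℝ) =
      ∑ t ∈ range m, ((step (level J σ) π k y t).card : ℝ) := by
    intro σ π
    rw [GeomAlg.cost, ← Fin.sum_univ_eq_sum_range
      (fun t => ((step (level J σ) π k y t).card : ℝ))]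
    push_cast
    exact sum_congr rfl fun t _ => by rw [touched_treapAlg]
  simp_rw [hcost]
  refine (sum_le_sum fun σ _ => sum_card_step_le (spread_level hJ σ) (level_le J σ) hk y m).trans ?_
  rw [← mul_sum, mul_assoc (n.factorial : ℝ)]
  refine mul_le_mul_of_nonneg_left ?_ (by positivity)
  rw [sum_add_distrib, sum_const, card_range, nsmul_eq_mul, ← mul_sum, sum_comm,
    mul_add (spacing J : ℝ)]
  refine add_le_add le_rfl ?_
  have hterm : ∀ t : Fin m, ∑ σ ∈ range (spacing J), ∑ j ∈ range (J + 1),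
      2 ^ j * (miss (level J σ) j (window k y t) (y t) : ℝ) ≤
      spacing J * (33 * (if 1 ≤ (t : ℕ) then Real.logb 2 (ubkVal k x t : ℝ) else 0) +
        if (t : ℕ) = 0 then 2 ^ (J + 1) else 0) := by
    intro t
    rcases Nat.eq_zero_or_pos (t : ℕ) with ht | ht
    · rw [if_neg (by omega), if_pos ht, mul_zero, zero_add]
      have hgeom : ∑ j ∈ range (J + 1), (2 : ℝ) ^ j ≤ 2 ^ (J + 1) := by
        rw [geom_sum_eq (by norm_num)]
        norm_num
      calc _ ≤ ∑ σ ∈ range (spacing J), (2 : ℝ) ^ (J + 1) := by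
            refine sum_le_sum fun σ _ => le_trans (sum_le_sum fun j _ => ?_) hgeom
            have : (miss (level J σ) j (window k y t) (y t) : ℝ) ≤ 1 := by
              exact_mod_cast miss_le_one
            exact mul_le_of_le_one_right (by positivity) this
        _ = _ := by simp
    · obtain ⟨s, hs, hcard, h3⟩ := exists_ubkVal (by omega : 1 ≤ k) x t ht
      rw [if_pos (by omega), if_neg (by omega), add_zero]
      exact sum_sum_miss_le h3 y hs (by rwa [hy, hy])
  rw [← Fin.sum_univ_eq_sum_range (fun t => ∑ σ ∈ range (spacing J), ∑ j ∈ range (J + 1),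
      2 ^ j * (miss (level J σ) j (window k y t) (y t) : ℝ))]
  have hsum := sum_le_sum fun t (_ : t ∈ univ) => hterm t
  rw [← mul_sum, sum_add_distrib, ← mul_sum] at hsum
  have hzero : ∑ t : Fin m, (if (t : ℕ) = 0 then (2 : ℝ) ^ (J + 1) else 0) ≤ 2 ^ (J + 1) := by
    rw [Fin.sum_univ_eq_sum_range (fun t => if t = 0 then (2 : ℝ) ^ (J + 1) else 0),
      sum_ite_eq' (range m) 0 fun _ => (2 : ℝ) ^ (J + 1)]
    split_ifs
    · rfl
    · positivity
  have h := hsum.trans (mul_le_mul_of_nonneg_left (add_le_add_right hzero _) (by positivity))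
  rw [UBk]
  linarith

end TreapBST

/-- There is a universal constant `C` such that for every `n ≥ 4` and every
integer `k ≥ 2` there is a finitely supported probability distribution over deterministic online
geometric BST algorithms — a randomized online algorithm `A` — with the property that for every
access sequence `X ∈ [n]^m` with `m ≥ n · (log₂ n)²`, the expected cost satisfies
`E[cost_A(X)] ≤ C · (UB^k(X) + m · log₂ k · log₂ log₂ n)`. -/
theorem stmt6 :
    ∃ C : ℝ, 0 < C ∧ ∀ (n k : ℕ), 4 ≤ n → 2 ≤ k →
      ∃ (N : ℕ) (p : Fin N → ℝ) (alg : Fin N → GeomAlg n),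
        (∀ i, 0 ≤ p i) ∧ (∑ i, p i) = 1 ∧ (∀ i, (alg i).Valid) ∧
        ∀ (m : ℕ) (x : Fin m → Fin n), (n : ℝ) * (Real.logb 2 n) ^ 2 ≤ m →
          (∑ i, p i * ((alg i).cost x : ℝ)) ≤
            C * (UBk k x + m * Real.logb 2 k * Real.logb 2 (Real.logb 2 n)) := by
  refine ⟨600, by norm_num, fun n k hn hk => ?_⟩
  set J := Nat.clog 2 (Nat.clog 2 n) with hJdef
  set c := Nat.clog 2 n with hcdef
  have hlogn : 2 ≤ Real.logb 2 n := by
    rw [Real.le_logb_iff_rpow_le (by norm_num) (by positivity)]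
    norm_num
    exact_mod_cast hn
  have hLL : 1 ≤ Real.logb 2 (Real.logb 2 n) := by
    rw [Real.le_logb_iff_rpow_le (by norm_num) (by positivity)]
    simpa using hlogn
  have hc_le : (c : ℝ) ≤ 2 * Real.logb 2 n := by
    have := TreapBST.clog_le_logb_add_one (v := n) (by omega)
    linarith
  have hnc : n ≤ 2 ^ c := Nat.le_pow_clog (by norm_num) n
  have hc2 : 2 ≤ c := by
    by_contra! h
    have : 2 ^ c ≤ 2 ^ 1 := Nat.pow_le_pow_right (by norm_num) (by omega)
    omega
  have hnJ : n ≤ 2 ^ 2 ^ J :=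
    hnc.trans (Nat.pow_le_pow_right (by norm_num) (Nat.le_pow_clog (by norm_num) c))
  have hJ_le : (J : ℝ) + 1 ≤ 4 * Real.logb 2 (Real.logb 2 n) := by
    have h1 := TreapBST.clog_le_logb_add_one (v := c) (by omega)
    have h2 : Real.logb 2 c ≤ Real.logb 2 (2 * Real.logb 2 n) :=
      Real.logb_le_logb_of_le (by norm_num) (by positivity) hc_le
    rw [Real.logb_mul (by norm_num) (by positivity), Real.logb_self_eq_one (by norm_num)] at h2
    linarith
  have hJ_pow : (2 : ℝ) ^ (J + 1) ≤ 8 * Real.logb 2 n := by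
    have h1 : 2 ^ J.pred < c := Nat.pow_pred_clog_lt_self (by norm_num) (by omega)
    have h2 : J + 1 = J.pred + 2 := by
      have : 0 < J := Nat.clog_pos (by norm_num) hc2
      rw [Nat.pred_eq_sub_one]
      omega
    have h3 : (2 : ℝ) ^ J.pred ≤ c := by exact_mod_cast h1.le
    rw [h2, pow_add]
    linarith
  have hk1 := TreapBST.one_le_logb hk
  let e : Fin n := ⟨0, by omega⟩
  let Ω := Fin (TreapBST.spacing J) × Equiv.Perm (Fin n)
  let φ : Fin (Fintype.card Ω) ≃ Ω := (Fintype.equivFin Ω).symm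
  have hcard : (Fintype.card Ω : ℝ) = n.factorial * TreapBST.spacing J := by
    simp [Ω, Fintype.card_perm, mul_comm]
  have hpos : (0 : ℝ) < Fintype.card Ω := by
    rw [hcard]
    have := TreapBST.spacing_pos J
    positivity
  refine ⟨Fintype.card Ω, fun _ => (Fintype.card Ω : ℝ)⁻¹,
    fun i => TreapBST.treapAlg (TreapBST.level J (φ i).1) (φ i).2 k e,
    fun _ => by positivity, by simp [hpos.ne'], fun i => TreapBST.valid_treapAlg _ _ _ _,
    fun m x hm => ?_⟩
  have hm_le : Real.logb 2 n ≤ m := by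
    refine le_trans ?_ hm
    have : (1 : ℝ) ≤ n := by exact_mod_cast (by omega : 1 ≤ n)
    nlinarith
  have hmprod : (m : ℝ) ≤ m * Real.logb 2 k * Real.logb 2 (Real.logb 2 n) := by
    rw [mul_assoc]
    exact le_mul_of_one_le_right (by positivity) (one_le_mul_of_one_le_of_one_le hk1 hLL)
  have hUB : 0 ≤ UBk k x := by
    refine Finset.sum_nonneg fun t _ => ?_
    split_ifs
    · rw [Real.logb]
      exact div_nonneg (Real.log_natCast_nonneg _) (Real.log_nonneg (by norm_num))
    · rfl
  have hsum := TreapBST.sum_cost_treapAlg_le hnJ hk e x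
  rw [← Finset.mul_sum, Equiv.sum_comp φ
    (fun ω => ((TreapBST.treapAlg (TreapBST.level J ω.1) ω.2 k e).cost x : ℝ)),
    Fintype.sum_prod_type, Fin.sum_univ_eq_sum_range (fun σ => ∑ π : Equiv.Perm (Fin n),
      ((TreapBST.treapAlg (TreapBST.level J σ) π k e).cost x : ℝ)), inv_mul_le_iff₀ hpos, hcard]
  refine hsum.trans (mul_le_mul_of_nonneg_left ?_ (by positivity))
  have hmain : (m : ℝ) * Real.logb 2 k * (J + 1) ≤
      m * Real.logb 2 k * (4 * Real.logb 2 (Real.logb 2 n)) :=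
    mul_le_mul_of_nonneg_left hJ_le (by positivity)
  linarith
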